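/- arXiv:1805.04039 — 2 statements merged into one kernel-verified Lean document; each statement's English description precedes it below -/
import Mathlib

section
/- Let k ≥ 1. There exists ε > 0 depending only on k such that for every set S with |S| ≤ k and every expander graph sequence (Γ_n), asymptotically almost surely (as n → ∞) the uniformly random S-labelling of Γ_n has the property that every word over S ⊔ S⁻¹ of length at most ε·log|V(Γ_n)| appears as the label of some simple path in Γ_n. -/
open Filter

/-- Outer vertex boundary of a set `A` in a graph `Γ`. -/
def vbdry {V : Type} (Γ : SimpleGraph V) (A : Set V) : Set V :=
  {v | v ∉ A ∧ ∃ a ∈ A, Γ.Adj v a}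

/-- `Γ` has Cheeger constant at least `h`. -/
def CheegerGE {V : Type} (Γ : SimpleGraph V) (h : ℝ) : Prop :=
  ∀ A : Set V, h * min A.ncard Aᶜ.ncard ≤ ((vbdry Γ A).ncard : ℝ)

/-- The label read along a dart: an `S`-labelling assigns a letter to each undirected
edge, and traversing the edge backwards reads the formal inverse `ι` of the letter. -/
def dartLabel {V A : Type} [LinearOrder V] {Γ : SimpleGraph V} (ι : A → A)
    (f : Γ.edgeSet → A) (d : Γ.Dart) : A :=
  if d.toProd.1 < d.toProd.2 then f ⟨d.edge, d.edge_mem⟩ else ι (f ⟨d.edge, d.edge_mem⟩)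

lemma dfs_state {V : Type} [Fintype V] [DecidableEq V] (Γ : SimpleGraph V) (t : ℕ) :
    t ≤ 2 * Fintype.card V → ∃ (F : Finset V) (l : List V), 2 * F.card + l.length = t ∧
      l.Nodup ∧ l.IsChain Γ.Adj ∧ (∀ x ∈ l, x ∉ F) ∧
      ∀ u, u ∉ F → u ∉ l → ∀ x ∈ F, ¬ Γ.Adj u x := by
  induction t with
  | zero => intro _; exact ⟨∅, [], by simp⟩
  | succ t ih =>
    intro ht
    obtain ⟨F, l, hc, hn, hch, hd, hF⟩ := ih (by omega)
    cases l with
    | nil =>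
      have : ∃ u, u ∉ F := by
        by_contra! hcon
        have : F = Finset.univ := by ext; simp [hcon]
        rw [this, Finset.card_univ] at hc
        simp at hc
        omega
      obtain ⟨u, hu⟩ := this
      refine ⟨F, [u], by simp at hc ⊢; omega, by simp, by simp, by simpa using hu, ?_⟩
      intro v hv _ x hx
      exact hF v hv (by simp) x hx
    | cons a l =>
      by_cases h : ∃ u, u ∉ F ∧ u ∉ a :: l ∧ Γ.Adj u a
      · obtain ⟨u, hu, hul, hua⟩ := h
        refine ⟨F, u :: a :: l, by simp at hc ⊢; omega, List.nodup_cons.2 ⟨hul, hn⟩,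
          List.isChain_cons_cons.2 ⟨hua, hch⟩, ?_, ?_⟩
        · intro x hx
          rcases List.mem_cons.1 hx with rfl | hx
          · exact hu
          · exact hd x hx
        · intro v hv hvl x hx
          exact hF v hv (fun h => hvl (List.mem_cons_of_mem _ h)) x hx
      · push Not at h
        have haF : a ∉ F := hd a (by simp)
        refine ⟨insert a F, l, by rw [Finset.card_insert_of_notMem haF]; simp at hc; omega,
          (List.nodup_cons.1 hn).2, hch.tail, ?_, ?_⟩
        · intro x hx
          have := hd x (List.mem_cons_of_mem _ hx)
          have : x ≠ a := by rintro rfl; exact (List.nodup_cons.1 hn).1 hx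
          simp [*]
        · intro u hu hul x hx
          simp at hu
          have hul' : u ∉ a :: l := by simp [hu.1, hul]
          rcases Finset.mem_insert.1 hx with rfl | hx
          · exact h u hu.2 hul'
          · exact hF u hu.2 hul' x hx

lemma long_path {V : Type} [Fintype V] (Γ : SimpleGraph V) (h : ℝ) (hh : 0 < h)
    (hC : CheegerGE Γ h) : ∃ l : List V, l.Nodup ∧ l.IsChain Γ.Adj ∧
      h * Fintype.card V ≤ (2 + h) * l.length := by
  classical
  obtain ⟨F, l, hc, hn, hch, hd, hF⟩ := dfs_state Γ (Fintype.card V) (by omega)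
  refine ⟨l, hn, hch, ?_⟩
  have h1 := hC (F : Set V)
  have h2 : (vbdry Γ (F : Set V)).ncard ≤ l.length := by
    have : vbdry Γ (F : Set V) ⊆ (l.toFinset : Set V) := by
      rintro v ⟨hv, a, ha, hva⟩
      by_contra hvl
      exact hF v (by simpa using hv) (by simpa using hvl) a (by simpa using ha) hva
    calc _ ≤ _ := Set.ncard_le_ncard this (Finset.finite_toSet _)
      _ ≤ _ := by rw [Set.ncard_coe_finset]; exact List.toFinset_card_le l
  have h3 : (F : Set V).ncard = F.card := Set.ncard_coe_finset _
  have h4 : (F : Set V).ncard + ((F : Set V)ᶜ).ncard = Fintype.card V := by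
    rw [Set.ncard_add_ncard_compl, Nat.card_eq_fintype_card]
  have h5 : min (((F : Set V).ncard : ℕ) : ℝ) ((((F : Set V)ᶜ).ncard : ℕ) : ℝ) = F.card := by
    rw [min_eq_left, h3]
    have : (F : Set V).ncard ≤ ((F : Set V)ᶜ).ncard := by omega
    exact_mod_cast this
  have h2' : ((vbdry Γ (F : Set V)).ncard : ℝ) ≤ l.length := by exact_mod_cast h2
  have hc' : (2 : ℝ) * F.card + l.length = Fintype.card V := by exact_mod_cast hc
  have h6 : h * F.card ≤ l.length := by
    rw [← h5]
    push_cast at h1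
    linarith
  rw [← hc']
  nlinarith

lemma bad_count {E A : Type} [Finite E] [Fintype A] [Nonempty A] (m L : ℕ)
    (e : Fin m × Fin L → E) (he : Function.Injective e) (w : Fin m → Fin L → A) :
    ∃ R : ℕ, 0 < R ∧ Nat.card (E → A) = R * (Fintype.card A ^ L) ^ m ∧
      Set.ncard {f : E → A | ∀ j, (fun i => f (e (j, i))) ≠ w j}
        = R * (Fintype.card A ^ L - 1) ^ m := by
  classical
  let C := {x // x ∈ (Set.range e)ᶜ}
  have : Finite C := inferInstance
  let φ : (E → A) ≃ (Fin m → Fin L → A) × (C → A) :=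
    ((Equiv.arrowCongr (((Equiv.ofInjective e he).sumCongr (Equiv.refl C)).trans
      (Equiv.Set.sumCompl (Set.range e))).symm (Equiv.refl A)).trans
      (Equiv.sumArrowEquivProdArrow _ _ _)).trans
      ((Equiv.curry _ _ _).prodCongr (Equiv.refl _))
  have hφ : ∀ f j i, (φ f).1 j i = f (e (j, i)) := by
    intro f j i
    simp [φ, Equiv.arrowCongr, Equiv.sumArrowEquivProdArrow]
    rfl
  have hR : 0 < Nat.card (C → A) := Nat.card_pos
  refine ⟨Nat.card (C → A), hR, ?_, ?_⟩
  · rw [Nat.card_congr φ, Nat.card_prod, mul_comm]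
    congr 1
    simp [Nat.card_eq_fintype_card]
  · have : {f : E → A | ∀ j, (fun i => f (e (j, i))) ≠ w j} = φ ⁻¹'
        (((Fintype.piFinset (fun j => ({w j}ᶜ : Finset (Fin L → A))) : Finset _) :
          Set (Fin m → Fin L → A)) ×ˢ Set.univ) := by
      ext f
      simp only [Set.mem_ofPred_eq, Set.mem_preimage, Set.mem_prod, Finset.mem_coe,
        Fintype.mem_piFinset, Finset.mem_compl, Finset.mem_singleton, Set.mem_univ, and_true]
      refine forall_congr' fun j => not_congr ?_
      rw [show (φ f).1 j = fun i => f (e (j, i)) from funext (hφ f j)]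
    rw [this, Set.ncard_preimage_of_injective_subset_range φ.injective (by simp),
      Set.ncard_prod, Set.ncard_coe_finset, Fintype.card_piFinset, Set.ncard_univ, mul_comm]
    simp [Finset.card_compl]

lemma bern (q : ℝ) (hq : 1 ≤ q) (m : ℕ) : (q - 1) ^ m * (m + 1) ≤ q * q ^ m := by
  have h1 : (1 : ℝ) + m * (1 / q) ≤ (1 + 1 / q) ^ m :=
    one_add_mul_le_pow (by have : 0 ≤ 1 / q := by positivity
                           linarith) m
  have hq0 : 0 < q := by linarith
  have h2 : (q - 1) ^ m * (1 + 1 / q) ^ m ≤ q ^ m := by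
    rw [← mul_pow]
    apply pow_le_pow_left₀
    · have : 0 ≤ q - 1 := by linarith
      positivity
    · have : (q - 1) * (1 + 1 / q) = q - 1 / q := by field_simp; ring
      rw [this]
      have : 0 ≤ 1 / q := by positivity
      linarith
  have h3 : (0 : ℝ) ≤ (q - 1) ^ m := pow_nonneg (by linarith) m
  have h4 : (m : ℝ) + 1 ≤ q * (1 + m * (1 / q)) := by
    have : q * (1 + m * (1 / q)) = q + m := by field_simp
    linarith
  calc (q - 1) ^ m * (m + 1) ≤ (q - 1) ^ m * (q * (1 + 1 / q) ^ m) := by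
        apply mul_le_mul_of_nonneg_left _ h3
        exact h4.trans (mul_le_mul_of_nonneg_left h1 hq0.le)
    _ = q * ((q - 1) ^ m * (1 + 1 / q) ^ m) := by ring
    _ ≤ _ := mul_le_mul_of_nonneg_left h2 hq0.le

lemma good_count {E A : Type} [Finite E] [Fintype A] [Nonempty A] (m L : ℕ)
    (e : Fin m × Fin L → E) (he : Function.Injective e) (σ : Fin m × Fin L → Equiv.Perm A)
    (G : Set (E → A))
    (hG : ∀ f, (∀ W : Fin L → A, ∃ j, ∀ i, σ (j, i) (f (e (j, i))) = W i) → f ∈ G) :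
    1 - ((Fintype.card A : ℝ) ^ L) ^ 2 / (m + 1) ≤ (G.ncard : ℝ) / Nat.card (E → A) := by
  classical
  set q : ℕ := Fintype.card A ^ L with hq
  have hq1 : 1 ≤ q := Nat.one_le_pow _ _ Fintype.card_pos
  have hT : 0 < Nat.card (E → A) := Nat.card_pos
  let B (W : Fin L → A) : Set (E → A) :=
    {f | ∀ j, (fun i => f (e (j, i))) ≠ fun i => (σ (j, i)).symm (W i)}
  have hB : ∀ W, ((B W).ncard : ℝ) * (m + 1) ≤ q * Nat.card (E → A) := by
    intro W
    obtain ⟨R, hR, h1, h2⟩ := bad_count m L e he (fun j i => (σ (j, i)).symm (W i))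
    rw [h2, h1]
    have := bern q (by exact_mod_cast hq1) m
    push_cast [Nat.cast_sub hq1, ← hq]
    have hR' : (0 : ℝ) ≤ R := by positivity
    nlinarith [mul_le_mul_of_nonneg_left this hR']
  have hsub : Gᶜ ⊆ ⋃ W ∈ (Finset.univ : Finset (Fin L → A)), B W := by
    intro f hf
    by_contra hcon
    apply hf
    apply hG
    intro W
    simp only [Set.mem_iUnion, not_exists] at hcon
    have := hcon W (Finset.mem_univ _)
    simp only [B, Set.mem_ofPred_eq, not_forall, not_not] at this
    obtain ⟨j, hj⟩ := this
    refine ⟨j, fun i => ?_⟩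
    have := congrFun hj i
    rw [this, Equiv.apply_symm_apply]
  have h1 : (Gᶜ.ncard : ℝ) ≤ ∑ W : Fin L → A, ((B W).ncard : ℝ) := by
    have := (Set.ncard_le_ncard hsub (Set.toFinite _)).trans (Finset.set_ncard_biUnion_le _ _)
    exact_mod_cast this
  have h2 : (Gᶜ.ncard : ℝ) * (m + 1) ≤ q * (q * Nat.card (E → A)) := by
    calc _ ≤ (∑ W : Fin L → A, ((B W).ncard : ℝ)) * (m + 1) := by gcongr
      _ = ∑ W : Fin L → A, ((B W).ncard : ℝ) * (m + 1) := Finset.sum_mul _ _ _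
      _ ≤ ∑ W : Fin L → A, (q * Nat.card (E → A) : ℝ) := Finset.sum_le_sum fun W _ => hB W
      _ = _ := by simp [hq]
  have h3 : (G.ncard : ℝ) + Gᶜ.ncard = Nat.card (E → A) := by
    exact_mod_cast Set.ncard_add_ncard_compl G
  have hT' : (0 : ℝ) < Nat.card (E → A) := by exact_mod_cast hT
  have hm : (0 : ℝ) < m + 1 := by positivity
  rw [show ((Fintype.card A : ℝ) ^ L) = q by simp [hq]]
  rw [le_div_iff₀ hT', sub_mul, one_mul, div_mul_eq_mul_div, sub_le_iff_le_add, ← h3]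
  have : (Gᶜ.ncard : ℝ) ≤ (q : ℝ) ^ 2 * ((G.ncard : ℝ) + Gᶜ.ncard) / (m + 1) := by
    rw [le_div_iff₀ hm, h3]; linarith
  linarith

lemma exists_walk {V : Type} (Γ : SimpleGraph V) (g : ℕ → V) (L : ℕ)
    (hg : ∀ i < L, Γ.Adj (g i) (g (i + 1))) :
    ∃ p : Γ.Walk (g 0) (g L), p.length = L ∧ ∀ i ≤ L, p.getVert i = g i := by
  induction L generalizing g with
  | zero => exact ⟨.nil, rfl, by simp⟩
  | succ L ih =>
    obtain ⟨p, hp, hv⟩ := ih (fun i => g (i + 1)) (fun i hi => hg (i + 1) (by omega))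
    refine ⟨.cons (hg 0 (by omega)) p, by simp [hp], ?_⟩
    intro i hi
    cases i with
    | zero => simp
    | succ i => simpa using hv i (by omega)

lemma fin_version {A : Type} [Fintype A] [Nonempty A] (ι : A → A) (hι : ∀ a, ι (ι a) = a)
    {V : Type} [Fintype V] [LinearOrder V] (Γ : SimpleGraph V) (h : ℝ) (hh : 0 < h)
    (hC : CheegerGE Γ h) (hV : 0 < Fintype.card V) (L : ℕ) (G : Set (Γ.edgeSet → A))
    (hG : ∀ f : Γ.edgeSet → A, (∀ L' ≤ L, ∀ w : Fin L' → A,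
      ∃ (u v : V) (p : Γ.Walk u v), p.IsPath ∧
        ∃ hlen : p.length = L', ∀ i : Fin L', dartLabel ι f (p.darts.get
            (Fin.cast (by rw [SimpleGraph.Walk.length_darts, hlen]) i)) = w i) → f ∈ G) :
    1 - ((Fintype.card A : ℝ) ^ L) ^ 2 * ((L + 1) * ((2 + h) / h) / Fintype.card V)
      ≤ (G.ncard : ℝ) / Nat.card (Γ.edgeSet → A) := by
  obtain ⟨l, hn, hch, hl⟩ := long_path Γ h hh hC
  have hV' : (0 : ℝ) < Fintype.card V := by exact_mod_cast hV
  have : Nonempty V := Fintype.card_pos_iff.1 hV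
  let m := l.length / (L + 1)
  let P : ℕ → V := fun i => if hi : i < l.length then l[i] else Classical.arbitrary V
  have hP : ∀ i (hi : i < l.length), P i = l[i] := fun i hi => by simp [P, hi]
  have hPinj : ∀ i j, i < l.length → j < l.length → P i = P j → i = j := by
    intro i j hi hj hij
    rw [hP i hi, hP j hj] at hij
    exact (hn.getElem_inj_iff).1 hij
  have hPadj : ∀ i, i + 1 < l.length → Γ.Adj (P i) (P (i + 1)) := by
    intro i hi
    rw [hP i (by omega), hP (i + 1) hi]
    exact List.isChain_iff_getElem.1 hch i hi
  have hidx : ∀ (j : Fin m) i, i ≤ L → j * (L + 1) + i < l.length := by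
    intro j i hi
    have h1 : ((j : ℕ) + 1) * (L + 1) ≤ m * (L + 1) := Nat.mul_le_mul_right _ j.2
    have h2 : m * (L + 1) ≤ l.length := Nat.div_mul_le_self _ _
    have h3 : ((j : ℕ) + 1) * (L + 1) = j * (L + 1) + (L + 1) := by ring
    omega
  let e : Fin m × Fin L → Γ.edgeSet := fun x =>
    ⟨s(P (x.1 * (L + 1) + x.2), P (x.1 * (L + 1) + x.2 + 1)),
      hPadj _ (hidx x.1 (x.2 + 1) x.2.2)⟩
  have he : Function.Injective e := by
    rintro ⟨j, i⟩ ⟨j', i'⟩ hji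
    have h1 := congrArg Subtype.val hji
    simp only [e, Sym2.eq_iff] at h1
    have b1 := hidx j i i.2.le
    have b2 := hidx j (i + 1) i.2
    have b3 := hidx j' i' i'.2.le
    have b4 := hidx j' (i' + 1) i'.2
    have h2 : (j : ℕ) * (L + 1) + i = j' * (L + 1) + i' := by
      rcases h1 with ⟨h1, -⟩ | ⟨h1, h2⟩
      · exact hPinj _ _ b1 b3 h1
      · have := hPinj _ _ b1 b4 h1
        have := hPinj _ _ b2 b3 h2
        omega
    have hi := i.2
    have hi' := i'.2
    have h3 : (i : ℕ) = i' := by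
      have := congrArg (· % (L + 1)) h2
      simp only [Nat.mul_add_mod_self_right] at this
      rwa [Nat.mod_eq_of_lt (by omega), Nat.mod_eq_of_lt (by omega)] at this
    have h4 : (j : ℕ) = j' := by
      rw [h3] at h2
      exact Nat.eq_of_mul_eq_mul_right (Nat.succ_pos L) (Nat.add_right_cancel h2)
    exact Prod.ext (Fin.ext h4) (Fin.ext h3)
  let σ : Fin m × Fin L → Equiv.Perm A := fun x =>
    if P (x.1 * (L + 1) + x.2) < P (x.1 * (L + 1) + x.2 + 1) then Equiv.refl A
    else ⟨ι, ι, hι, hι⟩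
  have key := good_count m L e he σ G (by
    intro f hf
    apply hG
    intro L' hL' w
    obtain ⟨j, hj⟩ := hf (fun i => if hi : (i : ℕ) < L' then w ⟨i, hi⟩ else Classical.arbitrary A)
    obtain ⟨p, hp, hv⟩ := exists_walk Γ (fun i => P (j * (L + 1) + i)) L'
      (fun i hi => hPadj _ (hidx j (i + 1) (by omega)))
    refine ⟨_, _, p, ?_, hp, ?_⟩
    · rw [← SimpleGraph.Walk.IsPath.getVert_injOn_iff]
      intro a ha b hb hab
      simp only [Set.mem_ofPred_eq, hp] at ha hb
      rw [hv a ha, hv b hb] at hab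
      have := hPinj _ _ (hidx j a (by omega)) (hidx j b (by omega)) hab
      omega
    · intro i
      have hi := i.2
      have h1 := hj ⟨i, by omega⟩
      simp only [hi, dif_pos] at h1
      rw [← h1]
      have hd : (p.darts.get (Fin.cast (by rw [SimpleGraph.Walk.length_darts, hp]) i)) =
          ⟨(P (j * (L + 1) + i), P (j * (L + 1) + i + 1)),
            hPadj _ (hidx j (i + 1) (by omega))⟩ := by
        apply SimpleGraph.Dart.ext
        rw [List.get_eq_getElem, SimpleGraph.Walk.darts_getElem_eq_getVert]
        simp only [Fin.val_cast]
        rw [hv i hi.le, hv (i + 1) hi]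
        rfl
      rw [hd]
      simp only [dartLabel, σ, e]
      split_ifs <;> rfl)
  refine le_trans ?_ key
  have hm : (l.length : ℝ) ≤ (m + 1) * (L + 1) := by
    have : l.length < (m + 1) * (L + 1) := by
      have := Nat.lt_div_mul_add (a := l.length) (Nat.succ_pos L)
      have h3 : (m + 1) * (L + 1) = m * (L + 1) + (L + 1) := by ring
      rw [h3]; exact this
    exact_mod_cast this.le
  have h1 : 1 / ((m : ℝ) + 1) ≤ (L + 1) * ((2 + h) / h) / Fintype.card V := by
    rw [div_le_div_iff₀ (by positivity) hV', mul_div_assoc', div_mul_eq_mul_div,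
      le_div_iff₀ hh]
    nlinarith
  have h2 := mul_le_mul_of_nonneg_left h1 (sq_nonneg ((Fintype.card A : ℝ) ^ L))
  rw [mul_one_div] at h2
  linarith

/-- For `k ≥ 1` there is `ε > 0` (depending only on `k`) such that for
every alphabet `S ⊔ S⁻¹` of size at most `2k` (with inverse involution `ι`) and every
expander sequence `(Γ n)`, asymptotically almost surely the uniformly random labelling
of `Γ n` is such that every word of length at most `ε·log |V(Γ n)|` labels a simple
path in `Γ n`. -/
theorem stmt_13 (k : ℕ) (hk : 1 ≤ k) :
    ∃ ε : ℝ, 0 < ε ∧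
      ∀ (A : Type) [Fintype A] [Nonempty A] (ι : A → A),
        Fintype.card A ≤ 2 * k → (∀ a, ι (ι a) = a) →
        ∀ (V : ℕ → Type) [∀ n, Fintype (V n)] [∀ n, LinearOrder (V n)]
          (Γ : ∀ n, SimpleGraph (V n)) [∀ n, DecidableRel (Γ n).Adj]
          (d : ℕ) (h : ℝ), 0 < h →
          (∀ n (v : V n), ((Γ n).neighborSet v).ncard ≤ d) →
          (∀ n, CheegerGE (Γ n) h) →
          Tendsto (fun n => Fintype.card (V n)) atTop atTop →
          Tendsto (fun n =>
              (Set.ncard {f : (Γ n).edgeSet → A |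
                  ∀ L : ℕ, (L : ℝ) ≤ ε * Real.log (Fintype.card (V n)) →
                    ∀ w : Fin L → A,
                      ∃ (u v : V n) (p : (Γ n).Walk u v), p.IsPath ∧
                        ∃ hlen : p.length = L, ∀ i : Fin L,
                          dartLabel ι f (p.darts.get
                            (Fin.cast (by rw [SimpleGraph.Walk.length_darts, hlen]) i))
                            = w i} : ℝ) /
                (Fintype.card ((Γ n).edgeSet → A) : ℝ))
            atTop (nhds 1) := by
  have hk' : (1 : ℝ) ≤ k := by exact_mod_cast hk
  refine ⟨1 / (8 * k), by positivity, ?_⟩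
  intro A _ _ ι hA hι V _ _ Γ _ d h hh _ hC hV
  have hlim : Tendsto (fun z : ℝ => 1 - ((2 + h) / h) * ((2 * z + 1) * Real.exp (-z)))
      atTop (nhds 1) := by
    have h1 := Real.tendsto_pow_mul_exp_neg_atTop_nhds_zero 1
    have h0 := Real.tendsto_pow_mul_exp_neg_atTop_nhds_zero 0
    have := (((h1.const_mul 2).add h0).const_mul ((2 + h) / h)).const_sub 1
    simp only [mul_zero, add_zero, sub_zero] at this
    refine this.congr fun z => ?_
    ring
  have hz : Tendsto (fun n => Real.log (Fintype.card (V n)) / 2) atTop atTop :=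
    (Real.tendsto_log_atTop.comp (tendsto_natCast_atTop_atTop.comp hV)).atTop_div_const two_pos
  refine tendsto_of_tendsto_of_tendsto_of_le_of_le' (hlim.comp hz) tendsto_const_nhds ?_ ?_
  · filter_upwards [hV.eventually_ge_atTop 1] with n hn
    rw [← Nat.card_eq_fintype_card (α := (Γ n).edgeSet → A)]
    have hN1 : (1 : ℝ) ≤ Fintype.card (V n) := by exact_mod_cast hn
    have hN0 : (0 : ℝ) < Fintype.card (V n) := by linarith
    have hlog : 0 ≤ Real.log (Fintype.card (V n)) := Real.log_nonneg hN1
    refine le_trans ?_ (fin_version ι hι (Γ n) h hh (hC n) hn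
      ⌊1 / (8 * k) * Real.log (Fintype.card (V n))⌋₊ _ ?_)
    · simp only [Function.comp_apply]
      set y := Real.log (Fintype.card (V n)) with hy
      set L := ⌊1 / (8 * k) * y⌋₊ with hL
      have hLy : (L : ℝ) ≤ 1 / (8 * k) * y := Nat.floor_le (by positivity)
      have hLy2 : 8 * k * (L : ℝ) ≤ y := by
        have := mul_le_mul_of_nonneg_left hLy (by positivity : (0 : ℝ) ≤ 8 * k)
        rwa [← mul_assoc, mul_one_div_cancel (by positivity), one_mul] at this
      have hL0 : (0 : ℝ) ≤ L := by positivity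
      have hLy3 : (L : ℝ) ≤ y := by nlinarith
      have hNe : (Fintype.card (V n) : ℝ) = Real.exp y := (Real.exp_log hN0).symm
      have hq : ((Fintype.card A : ℝ) ^ L) ^ 2 ≤ Real.exp (y / 2) := by
        have hA' : (Fintype.card A : ℝ) ≤ Real.exp (2 * k) := by
          have h1 : (Fintype.card A : ℝ) ≤ 2 * k := by exact_mod_cast hA
          have := Real.add_one_le_exp (2 * k : ℝ)
          linarith
        calc ((Fintype.card A : ℝ) ^ L) ^ 2 ≤ (Real.exp (2 * k) ^ L) ^ 2 := by gcongr
          _ = Real.exp (4 * k * L) := by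
            rw [← Real.exp_nat_mul, ← Real.exp_nat_mul]; congr 1; push_cast; ring
          _ ≤ _ := Real.exp_le_exp.2 (by linarith)
      have hc : 0 < (2 + h) / h := by positivity
      have : ((Fintype.card A : ℝ) ^ L) ^ 2 *
          ((L + 1) * ((2 + h) / h) / Fintype.card (V n)) ≤
          (2 + h) / h * ((2 * (y / 2) + 1) * Real.exp (-(y / 2))) := by
        calc _ ≤ Real.exp (y / 2) * ((y + 1) * ((2 + h) / h) / Fintype.card (V n)) := by
              gcongr
          _ = _ := by
            rw [hNe, div_eq_mul_inv _ (Real.exp y), ← Real.exp_neg,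
              show Real.exp (-(y / 2)) = Real.exp (y / 2) * Real.exp (-y) by
                rw [← Real.exp_add]; congr 1; ring]
            ring
      linarith
    · intro f hf L' hL' w
      exact hf L' (Nat.le_floor hL') w
  · refine Eventually.of_forall fun n => ?_
    rw [← Nat.card_eq_fintype_card (α := (Γ n).edgeSet → A)]
    apply div_le_one_of_le₀ _ (by positivity)
    exact Nat.cast_le.2 (Set.ncard_le_card _)
end

section
/- Let Θ be a d-regular graph with girth g and diam(Θ) ≤ C·g, let j ≥ 1, and let m, v₁ be vertices of Θ^{(j)} with ε·jg ≤ d(m,v₁) ≤ jg/4 where 0 < ε ≤ 1/8. Let Σ be the set of vertices σ at distance exactly ⌊ε·jg/2⌋ from v₁ in Θ^{(j)} such that the geodesic from σ to v₁ meets the geodesic from m to v₁ only in v₁. Then |Σ| ≥ (d−1)^{εg/2 − 2}, and there exists μ > 0 depending only on C, d, j, ε such that |Σ| ≥ |V(Θ^{(j)})|^μ for all sufficiently large g. -/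
/-- Interior vertices of the `j`-subdivision: an oriented edge `x < y` of `Γ` together
with a position `i ∈ Fin (j-1)`. -/
def SubIdx {V : Type} [LinearOrder V] (Γ : SimpleGraph V) (j : ℕ) : Type :=
  {p : V × V × Fin (j - 1) // p.1 < p.2.1 ∧ Γ.Adj p.1 p.2.1}

/-- The `j`-subdivision of `Γ`: each edge is replaced by a path of length `j`. -/
def subdiv {V : Type} [LinearOrder V] (Γ : SimpleGraph V) (j : ℕ) :
    SimpleGraph (V ⊕ SubIdx Γ j) :=
  SimpleGraph.fromRel (fun u v =>
    match u, v with
    | .inl a, .inl b => j = 1 ∧ Γ.Adj a b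
    | .inl a, .inr ⟨(x, y, i), _⟩ => (a = x ∧ (i : ℕ) = 0) ∨ (a = y ∧ (i : ℕ) + 2 = j)
    | .inr ⟨(x, y, i), _⟩, .inr ⟨(x', y', i'), _⟩ =>
        x = x' ∧ y = y' ∧ (i : ℕ) + 1 = (i' : ℕ)
    | _, _ => False)

instance {V : Type} [LinearOrder V] [Fintype V] [DecidableEq V] (Γ : SimpleGraph V)
    [DecidableRel Γ.Adj] (j : ℕ) : Fintype (SubIdx Γ j) := by
  unfold SubIdx; infer_instance

/-- The set `Σ` of vertices `σ` at distance exactly `⌊ε·jg/2⌋` from `v₁` such that any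
geodesic from `σ` to `v₁` meets any geodesic from `m` to `v₁` only in `v₁`. -/
def SigmaSet {V : Type} [LinearOrder V] (Γ : SimpleGraph V) (j : ℕ)
    (m v₁ : V ⊕ SubIdx Γ j) (r : ℕ) : Set (V ⊕ SubIdx Γ j) :=
  {σ | (subdiv Γ j).dist v₁ σ = r ∧
    ∀ (p : (subdiv Γ j).Walk σ v₁) (q : (subdiv Γ j).Walk m v₁),
      p.length = (subdiv Γ j).dist σ v₁ → q.length = (subdiv Γ j).dist m v₁ →
      ∀ x, x ∈ p.support → x ∈ q.support → x = v₁}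

section Generic

open SimpleGraph

lemma leafless_not_acyclic {V : Type} [Finite V] (H : SimpleGraph V) {a b : V} (hab : H.Adj a b)
    (h : ∀ a b, H.Adj a b → ∃ c, c ≠ b ∧ H.Adj a c) : ¬ H.IsAcyclic := by
  intro hac
  have : Nonempty V := ⟨a⟩
  obtain ⟨u, v, p, hp, hmax⟩ := Walk.exists_isPath_forall_isPath_length_le_length H
  have hnil : ¬ p.Nil := by
    intro hn
    have := hmax _ _ (Walk.cons hab Walk.nil) (by simp [hab.ne])
    have h2 := Walk.nil_iff_length_eq.mp hn
    simp at this
    omega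
  obtain ⟨c, hc, hadj⟩ := h u p.snd (p.adj_snd hnil)
  apply hc
  apply hac.eq_snd_of_adj_start hp hadj
  by_contra hns
  have := hmax _ _ (p.cons hadj.symm) (hp.cons hns)
  simp at this

lemma leafless_girth {V : Type} [Fintype V] (G H : SimpleGraph V) (hle : H ≤ G) {a b : V}
    (hab : H.Adj a b) (h : ∀ a b, H.Adj a b → ∃ c, c ≠ b ∧ H.Adj a c) [Fintype H.edgeSet] :
    G.girth ≤ H.edgeFinset.card := by
  have := leafless_not_acyclic H hab h
  unfold IsAcyclic at this
  push Not at this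
  obtain ⟨v, c, hc⟩ := this
  have h1 : G.girth ≤ (c.mapLe hle).length := girth_le_length (hc.mapLe hle)
  have h2 := hc.isTrail.length_le_card_edgeFinset
  rw [Walk.length_map] at h1
  omega

lemma path_unique_of_short {V : Type} {G : SimpleGraph V} {L : ℕ}
    (hL : ∀ v (c : G.Walk v v), c.IsCycle → L ≤ c.length) {a b : V} (p q : G.Walk a b)
    (hp : p.IsPath) (hq : q.IsPath) (hlen : p.length + q.length < L) : p = q := by
  classical
  let S : Set (Sym2 V) := {e | e ∈ p.edges ∨ e ∈ q.edges}
  let H : SimpleGraph V := SimpleGraph.fromEdgeSet S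
  have hS : ∀ e ∈ S, e ∈ G.edgeSet := by
    rintro e (he | he)
    · exact p.edges_subset_edgeSet he
    · exact q.edges_subset_edgeSet he
  have hH : ∀ e ∈ S, e ∈ H.edgeSet := by
    intro e he
    simp only [H, edgeSet_fromEdgeSet]
    exact ⟨he, fun h => G.not_isDiag_of_mem_edgeSet (hS e he) h⟩
  have hHS : ∀ e ∈ H.edgeSet, e ∈ S := by
    intro e he
    simp only [H, edgeSet_fromEdgeSet] at he
    exact he.1
  have hac : H.IsAcyclic := by
    intro v c hc
    have hcS : ∀ e ∈ c.edges, e ∈ S := fun e he => hHS e (c.edges_subset_edgeSet he)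
    have h1 := hL v (c.transfer G (fun e he => hS e (hcS e he))) (hc.transfer _)
    rw [Walk.length_transfer] at h1
    have h2 : c.edges.toFinset.card = c.length := by
      rw [List.toFinset_card_of_nodup hc.isTrail.edges_nodup, Walk.length_edges]
    have h3 : c.edges.toFinset ⊆ p.edges.toFinset ∪ q.edges.toFinset := by
      intro e he
      simp only [Finset.mem_union, List.mem_toFinset] at he ⊢
      exact hcS e he
    have h4 := (Finset.card_le_card h3).trans (Finset.card_union_le _ _)
    have h5 := p.edges.toFinset_card_le
    have h6 := q.edges.toFinset_card_le
    rw [Walk.length_edges] at h5 h6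
    omega
  have hpe : ∀ e ∈ p.edges, e ∈ H.edgeSet := fun e he => hH e (Or.inl he)
  have hqe : ∀ e ∈ q.edges, e ∈ H.edgeSet := fun e he => hH e (Or.inr he)
  have := hac.path_unique ⟨p.transfer H hpe, hp.transfer hpe⟩ ⟨q.transfer H hqe, hq.transfer hqe⟩
  have h1 : p.transfer H hpe = q.transfer H hqe := congrArg Subtype.val this
  have h2 := congrArg Walk.support h1
  rw [Walk.support_transfer, Walk.support_transfer] at h2
  exact Walk.ext_support h2

/-- endpoints of paths of length `n` from `v` that avoid `u` -/
def TSet {V : Type} (G : SimpleGraph V) (u v : V) (n : ℕ) : Set V :=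
  {x | ∃ p : G.Walk v x, p.IsPath ∧ p.length = n ∧ u ∉ p.support}

lemma TSet_succ {V : Type} [Finite V] {G : SimpleGraph V} {L : ℕ}
    (hL : ∀ v (c : G.Walk v v), c.IsCycle → L ≤ c.length) {u v : V} (huv : G.Adj u v) {n : ℕ}
    (hn : 2 * (n + 1) < L) (W : Finset V) (hW : ∀ w ∈ W, G.Adj v w ∧ w ≠ u) :
    ∑ w ∈ W, (TSet G v w n).ncard ≤ (TSet G u v (n + 1)).ncard := by
  classical
  have hfin : ∀ w, (TSet G v w n).Finite := fun w => Set.toFinite _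
  have h1 : ∑ w ∈ W, (TSet G v w n).ncard = (W.biUnion (fun w => (hfin w).toFinset)).card := by
    rw [Finset.card_biUnion]
    · exact Finset.sum_congr rfl (fun w _ => Set.ncard_eq_toFinset_card _ _)
    · intro w hw w' hw' hne
      change Disjoint _ _
      rw [Finset.disjoint_left]
      intro x hx hx'
      simp only [Set.Finite.mem_toFinset] at hx hx'
      obtain ⟨p, hp, hpl, hps⟩ := hx
      obtain ⟨q, hq, hql, hqs⟩ := hx'
      have := path_unique_of_short hL (p.cons (hW w hw).1) (q.cons (hW w' hw').1)
        (hp.cons hps) (hq.cons hqs) (by simp; omega)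
      have h2 := congrArg (fun r => r.snd) this
      simp at h2
      exact hne h2
  rw [h1, ← Set.ncard_coe_finset]
  apply Set.ncard_le_ncard _ (Set.toFinite _)
  intro x hx
  simp only [Finset.coe_biUnion, Set.mem_iUnion, Finset.mem_coe, Set.Finite.mem_toFinset] at hx
  obtain ⟨w, hw, p, hp, hpl, hps⟩ := hx
  have hadj := (hW w hw).1
  refine ⟨p.cons hadj, hp.cons hps, by simp [hpl], ?_⟩
  rw [Walk.support_cons, List.mem_cons]
  rintro (h | h)
  · exact huv.ne h
  · have hlen := p.length_takeUntil_le_length h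
    have := path_unique_of_short hL ((p.takeUntil u h).cons hadj) (Walk.cons huv.symm Walk.nil)
      ((hp.takeUntil h).cons (fun h' => hps (p.support_takeUntil_subset_support h h')))
      (by simp [huv.ne']) (by simp; omega)
    have h2 := congrArg (fun r => r.snd) this
    simp at h2
    exact (hW w hw).2 h2

lemma TSet_zero {V : Type} {G : SimpleGraph V} {u v : V} (huv : G.Adj u v) :
    TSet G u v 0 = {v} := by
  ext x
  constructor
  · rintro ⟨p, -, hl, -⟩
    exact (Walk.eq_of_length_eq_zero hl).symm
  · rintro rfl
    exact ⟨Walk.nil, by simp, rfl, by simp [huv.ne]⟩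

end Generic
section Subdivision

open SimpleGraph

/-- The point at position `k` on the subdivided edge from `x` to `y`. -/
def PP {V : Type} [LinearOrder V] (Γ : SimpleGraph V) [DecidableRel Γ.Adj] (j : ℕ) (x y : V)
    (k : ℕ) : V ⊕ SubIdx Γ j :=
  if h0 : k = 0 then .inl x
  else if h : k < j ∧ Γ.Adj x y then
    if hlt : x < y then .inr ⟨(x, y, ⟨k - 1, by omega⟩), hlt, h.2⟩
    else .inr ⟨(y, x, ⟨j - k - 1, by omega⟩),
      lt_of_le_of_ne (not_lt.mp hlt) h.2.ne', h.2.symm⟩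
  else .inl y

variable {V : Type} [LinearOrder V] {Γ : SimpleGraph V} [DecidableRel Γ.Adj] {j : ℕ}

lemma PP_zero (x y : V) : PP Γ j x y 0 = .inl x := by simp [PP]

lemma PP_end (hj : 1 ≤ j) (x y : V) : PP Γ j x y j = .inl y := by
  unfold PP
  rw [dif_neg (by omega), dif_neg (by omega)]

lemma PP_lt {x y : V} (h : Γ.Adj x y) (hlt : x < y) {k : ℕ} (h0 : 0 < k) (hk : k < j) :
    PP Γ j x y k = .inr ⟨(x, y, ⟨k - 1, by omega⟩), hlt, h⟩ := by
  unfold PP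
  rw [dif_neg (by omega), dif_pos ⟨hk, h⟩, dif_pos hlt]

lemma PP_gt {x y : V} (h : Γ.Adj x y) (hlt : y < x) {k : ℕ} (h0 : 0 < k) (hk : k < j) :
    PP Γ j x y k = .inr ⟨(y, x, ⟨j - k - 1, by omega⟩), hlt, h.symm⟩ := by
  unfold PP
  rw [dif_neg (by omega), dif_pos ⟨hk, h⟩, dif_neg (not_lt.mpr hlt.le)]

lemma PP_symm (hj : 1 ≤ j) {x y : V} (h : Γ.Adj x y) {k : ℕ} (hk : k ≤ j) :
    PP Γ j y x (j - k) = PP Γ j x y k := by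
  rcases Nat.eq_zero_or_pos k with rfl | h0
  · rw [PP_zero, Nat.sub_zero, PP_end hj]
  rcases hk.eq_or_lt with rfl | hk
  · rw [Nat.sub_self, PP_zero, PP_end hj]
  rcases lt_trichotomy x y with hlt | rfl | hlt
  · rw [PP_lt h hlt h0 hk, PP_gt h.symm hlt (by omega) (by omega)]
    congr 5
    omega
  · exact (h.ne rfl).elim
  · rw [PP_gt h hlt h0 hk, PP_lt h.symm hlt (by omega) (by omega)]

lemma PP_eq_inl (hj : 1 ≤ j) {x y a : V} (h : Γ.Adj x y) {k : ℕ} (hk : k ≤ j)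
    (he : PP Γ j x y k = .inl a) : (k = 0 ∧ a = x) ∨ (k = j ∧ a = y) := by
  rcases Nat.eq_zero_or_pos k with rfl | h0
  · rw [PP_zero] at he
    exact Or.inl ⟨rfl, (Sum.inl.inj he).symm⟩
  rcases hk.eq_or_lt with rfl | hk
  · rw [PP_end hj] at he
    exact Or.inr ⟨rfl, (Sum.inl.inj he).symm⟩
  rcases lt_trichotomy x y with hlt | rfl | hlt
  · rw [PP_lt h hlt h0 hk] at he
    cases he
  · exact (h.ne rfl).elim
  · rw [PP_gt h hlt h0 hk] at he
    cases he

lemma PP_inj (hj : 1 ≤ j) {x y x' y' : V} (h : Γ.Adj x y) (h' : Γ.Adj x' y') {k k' : ℕ}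
    (h0 : 0 < k) (hk : k < j) (hk' : k' ≤ j) (he : PP Γ j x' y' k' = PP Γ j x y k) :
    (x' = x ∧ y' = y ∧ k' = k) ∨ (x' = y ∧ y' = x ∧ k' = j - k) := by
  have h0' : 0 < k' := by
    rcases Nat.eq_zero_or_pos k' with rfl | h0'
    · rw [PP_zero] at he
      have := PP_eq_inl hj h hk.le he.symm
      omega
    · exact h0'
  have hk' : k' < j := by
    rcases hk'.eq_or_lt with rfl | hk'
    · rw [PP_end hj] at he
      have := PP_eq_inl hj h hk.le he.symm
      omega
    · exact hk'
  rcases lt_trichotomy x y with hlt | heq | hlt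
  · rw [PP_lt h hlt h0 hk] at he
    rcases lt_trichotomy x' y' with hlt' | heq' | hlt'
    · rw [PP_lt h' hlt' h0' hk'] at he
      have := congrArg Subtype.val (Sum.inr.inj he)
      simp only [Prod.mk.injEq, Fin.mk.injEq] at this
      exact Or.inl ⟨this.1, this.2.1, by omega⟩
    · exact (h'.ne heq').elim
    · rw [PP_gt h' hlt' h0' hk'] at he
      have := congrArg Subtype.val (Sum.inr.inj he)
      simp only [Prod.mk.injEq, Fin.mk.injEq] at this
      exact Or.inr ⟨this.2.1, this.1, by omega⟩
  · exact (h.ne heq).elim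
  · rw [PP_gt h hlt h0 hk] at he
    rcases lt_trichotomy x' y' with hlt' | heq' | hlt'
    · rw [PP_lt h' hlt' h0' hk'] at he
      have := congrArg Subtype.val (Sum.inr.inj he)
      simp only [Prod.mk.injEq, Fin.mk.injEq] at this
      exact Or.inr ⟨this.1, this.2.1, by omega⟩
    · exact (h'.ne heq').elim
    · rw [PP_gt h' hlt' h0' hk'] at he
      have := congrArg Subtype.val (Sum.inr.inj he)
      simp only [Prod.mk.injEq, Fin.mk.injEq] at this
      exact Or.inl ⟨this.2.1, this.1, by omega⟩

lemma PP_inj_pos (hj : 1 ≤ j) {x y : V} (h : Γ.Adj x y) {k k' : ℕ}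
    (hk : k ≤ j) (hk' : k' ≤ j) (he : PP Γ j x y k' = PP Γ j x y k) : k' = k := by
  rcases Nat.eq_zero_or_pos k with rfl | h0
  · rw [PP_zero] at he
    rcases PP_eq_inl hj h hk' he with h1 | h1
    · exact h1.1
    · exact (h.ne h1.2).elim
  rcases hk.eq_or_lt with rfl | hk
  · rw [PP_end hj] at he
    rcases PP_eq_inl hj h hk' he with h1 | h1
    · exact (h.ne h1.2.symm).elim
    · exact h1.1
  rcases PP_inj hj h h h0 hk hk' he with h1 | h1
  · exact h1.2.2
  · exact (h.ne h1.1).elim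

lemma PP_one_inj (hj : 1 ≤ j) {x y z : V} (h : Γ.Adj x y) (h' : Γ.Adj x z)
    (he : PP Γ j x z 1 = PP Γ j x y 1) : z = y := by
  rcases hj.eq_or_lt with rfl | hj1
  · rw [PP_end le_rfl, PP_end le_rfl] at he
    exact Sum.inl.inj he
  · rcases PP_inj hj h h' one_pos hj1 hj he with h1 | h1
    · exact h1.2.1
    · exact (h.ne h1.1).elim

lemma subdiv_adj_PP (hj : 1 ≤ j) {x y : V} (h : Γ.Adj x y) {k : ℕ} (hk : k < j) :
    (subdiv Γ j).Adj (PP Γ j x y k) (PP Γ j x y (k + 1)) := by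
  have key : ∀ {x y : V}, Γ.Adj x y → x < y → ∀ {k : ℕ}, k < j →
      (subdiv Γ j).Adj (PP Γ j x y k) (PP Γ j x y (k + 1)) := by
    intro x y h hlt k hk
    have hne : PP Γ j x y k ≠ PP Γ j x y (k + 1) := by
      intro he
      have := PP_inj_pos hj h (by omega) (by omega) he
      omega
    unfold subdiv
    rw [SimpleGraph.fromRel_adj]
    refine ⟨hne, ?_⟩
    rcases Nat.eq_zero_or_pos k with rfl | h0
    · rcases hj.eq_or_lt with rfl | hj1
      · rw [PP_zero, PP_end le_rfl]
        exact Or.inl ⟨rfl, h⟩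
      · rw [PP_zero, PP_lt h hlt (by omega) (by omega)]
        exact Or.inl (Or.inl ⟨rfl, rfl⟩)
    · rcases (show k + 1 ≤ j from hk).eq_or_lt with hk1 | hk1
      · have : PP Γ j x y (k + 1) = .inl y := by rw [hk1, PP_end hj]
        rw [this, PP_lt h hlt h0 hk]
        refine Or.inr (Or.inr ⟨rfl, ?_⟩)
        simp only
        omega
      · rw [PP_lt h hlt h0 hk, PP_lt h hlt (by omega) hk1]
        refine Or.inl ⟨rfl, rfl, ?_⟩
        simp only
        omega
  rcases lt_trichotomy x y with hlt | heq | hlt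
  · exact key h hlt hk
  · exact (h.ne heq).elim
  · rw [← PP_symm hj h hk.le, ← PP_symm hj h (show k + 1 ≤ j from hk)]
    have := key h.symm hlt (k := j - (k + 1)) (by omega)
    rw [show j - (k + 1) + 1 = j - k by omega] at this
    exact this.symm

lemma subdiv_adj_exists (hj : 1 ≤ j) {u v : V ⊕ SubIdx Γ j} (huv : (subdiv Γ j).Adj u v) :
    ∃ x y k, Γ.Adj x y ∧ k < j ∧ u = PP Γ j x y k ∧ v = PP Γ j x y (k + 1) := by
  have flip : ∀ {u v : V ⊕ SubIdx Γ j},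
      (∃ x y k, Γ.Adj x y ∧ k < j ∧ u = PP Γ j x y k ∧ v = PP Γ j x y (k + 1)) →
      ∃ x y k, Γ.Adj x y ∧ k < j ∧ v = PP Γ j x y k ∧ u = PP Γ j x y (k + 1) := by
    rintro u v ⟨x, y, k, h, hk, rfl, rfl⟩
    refine ⟨y, x, j - (k + 1), h.symm, by omega, ?_, ?_⟩
    · rw [PP_symm hj h (by omega)]
    · rw [show j - (k + 1) + 1 = j - k by omega, PP_symm hj h (by omega)]
  have case2 : ∀ (a x y : V) (i : Fin (j - 1)) (hp : x < y ∧ Γ.Adj x y),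
      ((a = x ∧ (i : ℕ) = 0) ∨ (a = y ∧ (i : ℕ) + 2 = j)) →
      ∃ x' y' k, Γ.Adj x' y' ∧ k < j ∧ (.inl a : V ⊕ SubIdx Γ j) = PP Γ j x' y' k ∧
        (.inr ⟨(x, y, i), hp⟩ : V ⊕ SubIdx Γ j) = PP Γ j x' y' (k + 1) := by
    intro a x y i hp h
    have hi := i.2
    rcases h with ⟨rfl, h0⟩ | ⟨rfl, h0⟩
    · refine ⟨a, y, 0, hp.2, by omega, (PP_zero _ _).symm, ?_⟩
      rw [PP_lt hp.2 hp.1 (by omega) (by omega)]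
      congr 5
      exact Fin.ext (by simp [h0])
    · apply flip
      refine ⟨x, a, i + 1, hp.2, by omega, ?_, ?_⟩
      · rw [PP_lt hp.2 hp.1 (by omega) (by omega)]
        rfl
      · rw [show (i : ℕ) + 1 + 1 = j by omega, PP_end hj]
  have case3 : ∀ (x y : V) (i : Fin (j - 1)) (hp : x < y ∧ Γ.Adj x y)
      (x' y' : V) (i' : Fin (j - 1)) (hp' : x' < y' ∧ Γ.Adj x' y'),
      (x = x' ∧ y = y' ∧ (i : ℕ) + 1 = (i' : ℕ)) →
      ∃ a b k, Γ.Adj a b ∧ k < j ∧ (.inr ⟨(x, y, i), hp⟩ : V ⊕ SubIdx Γ j) = PP Γ j a b k ∧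
        (.inr ⟨(x', y', i'), hp'⟩ : V ⊕ SubIdx Γ j) = PP Γ j a b (k + 1) := by
    rintro x y i hp x' y' i' hp' ⟨rfl, rfl, h⟩
    have hi := i.2
    have hi' := i'.2
    refine ⟨x, y, i + 1, hp.2, by omega, ?_, ?_⟩
    · rw [PP_lt hp.2 hp.1 (by omega) (by omega)]
      rfl
    · rw [PP_lt hp.2 hp.1 (by omega) (by omega)]
      congr 5
      exact Fin.ext (by simp [h])
  unfold subdiv at huv
  rw [SimpleGraph.fromRel_adj] at huv
  obtain ⟨-, huv⟩ := huv
  rcases u with a | ⟨⟨x, y, i⟩, hp⟩ <;> rcases v with b | ⟨⟨x', y', i'⟩, hp'⟩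
  · have : j = 1 ∧ Γ.Adj a b := by
      rcases huv with h | h
      · exact h
      · exact ⟨h.1, h.2.symm⟩
    obtain ⟨rfl, h⟩ := this
    exact ⟨a, b, 0, h, one_pos, (PP_zero _ _).symm, (PP_end le_rfl _ _).symm⟩
  · rcases huv with h | h
    · exact case2 _ _ _ _ hp' h
    · exact h.elim
  · rcases huv with h | h
    · exact h.elim
    · exact flip (case2 _ _ _ _ hp h)
  · rcases huv with h | h
    · exact case3 _ _ _ hp _ _ _ hp' h
    · exact flip (case3 _ _ _ hp' _ _ _ hp h)

lemma subdiv_adj_interior (hj : 1 ≤ j) {x y : V} (h : Γ.Adj x y) {k : ℕ} (hk : k + 1 < j)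
    {v : V ⊕ SubIdx Γ j} (hv : (subdiv Γ j).Adj (PP Γ j x y (k + 1)) v) :
    v = PP Γ j x y k ∨ v = PP Γ j x y (k + 2) := by
  obtain ⟨x', y', k', h', hk', hu, hv'⟩ := subdiv_adj_exists hj hv
  rcases PP_inj hj h h' (by omega) hk hk'.le hu.symm with ⟨rfl, rfl, rfl⟩ | ⟨rfl, rfl, hkk⟩
  · exact Or.inr hv'
  · left
    rw [hv', ← PP_symm hj h (show k ≤ j by omega)]
    congr 1
    omega

lemma subdiv_adj_inl (hj : 1 ≤ j) {x : V} {v : V ⊕ SubIdx Γ j}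
    (hv : (subdiv Γ j).Adj (.inl x) v) : ∃ y, Γ.Adj x y ∧ v = PP Γ j x y 1 := by
  obtain ⟨x', y', k', h', hk', hu, hv⟩ := subdiv_adj_exists hj hv
  rcases PP_eq_inl hj h' hk'.le hu.symm with ⟨rfl, rfl⟩ | ⟨rfl, rfl⟩
  · exact ⟨y', h', hv⟩
  · omega

lemma subdiv_cycle_length [Fintype V] (hj : 1 ≤ j) {v : V ⊕ SubIdx Γ j}
    (c : (subdiv Γ j).Walk v v) (hc : c.IsCycle) : j * Γ.girth ≤ c.length := by
  classical
  have leaf : ∀ a b, s(a, b) ∈ c.edges → ∃ b', b' ≠ b ∧ s(a, b') ∈ c.edges := by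
    intro a b hab
    have h2 := hc.ncard_neighborSet_toSubgraph_eq_two (c.fst_mem_support_of_mem_edges hab)
    have h3 : 1 < (c.toSubgraph.neighborSet a).ncard := by omega
    obtain ⟨b', hb', hne⟩ := Set.exists_ne_of_one_lt_ncard h3 b
    refine ⟨b', hne, ?_⟩
    rw [Subgraph.mem_neighborSet, Walk.adj_toSubgraph_iff_mem_edges] at hb'
    exact hb'
  have cadj : ∀ {a b}, s(a, b) ∈ c.edges → (subdiv Γ j).Adj a b := by
    intro a b h
    exact c.adj_of_mem_edges h
  let Q : V → V → ℕ → Prop := fun x y k => s(PP Γ j x y k, PP Γ j x y (k + 1)) ∈ c.edges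
  have Qsymm : ∀ {x y k}, Γ.Adj x y → k < j → Q x y k → Q y x (j - (k + 1)) := by
    intro x y k h hk hQ
    change s(_, _) ∈ _
    rw [show j - (k + 1) + 1 = j - k by omega, PP_symm hj h (by omega), PP_symm hj h (by omega),
      Sym2.eq_swap]
    exact hQ
  have Qup : ∀ {x y k}, Γ.Adj x y → k + 1 < j → Q x y k → Q x y (k + 1) := by
    intro x y k h hk hQ
    have hQ' : s(PP Γ j x y (k + 1), PP Γ j x y k) ∈ c.edges := by
      rw [Sym2.eq_swap]; exact hQ
    obtain ⟨b, hb, hbe⟩ := leaf _ _ hQ'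
    rcases subdiv_adj_interior hj h hk (cadj hbe) with h1 | h1
    · exact (hb h1).elim
    · rw [h1] at hbe
      exact hbe
  have Qup' : ∀ {x y k}, Γ.Adj x y → k < j → Q x y k → ∀ n, k + n < j → Q x y (k + n) := by
    intro x y k h hk hQ n
    induction n with
    | zero => intro _; exact hQ
    | succ n ih => intro hn; exact Qup h (by omega) (ih (by omega))
  have Qlast : ∀ {x y k}, Γ.Adj x y → k < j → Q x y k → Q x y (j - 1) := by
    intro x y k h hk hQ
    have := Qup' h hk hQ (j - 1 - k) (by omega)
    rwa [show k + (j - 1 - k) = j - 1 by omega] at this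
  have Qzero : ∀ {x y k}, Γ.Adj x y → k < j → Q x y k → Q x y 0 := by
    intro x y k h hk hQ
    have := Qlast h.symm (by omega) (Qsymm h hk hQ)
    have := Qsymm h.symm (by omega) this
    rwa [show j - (j - 1 + 1) = 0 by omega] at this
  have Qall : ∀ {x y k}, Γ.Adj x y → k < j → Q x y k → ∀ n, n < j → Q x y n := by
    intro x y k h hk hQ n hn
    have := Qup' h (by omega) (Qzero h hk hQ) n (by omega)
    rwa [Nat.zero_add] at this
  let H : SimpleGraph V :=
    { Adj := fun x y => Γ.Adj x y ∧ Q x y 0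
      symm := ⟨by
        rintro x y ⟨h, hQ⟩
        exact ⟨h.symm, Qzero h.symm (by omega) (Qsymm h (by omega) hQ)⟩⟩
      loopless := ⟨fun x h => h.1.ne rfl⟩ }
  have hle : H ≤ Γ := fun x y h => h.1
  have hne : ∃ a b, H.Adj a b := by
    have h1 : c.edges ≠ [] := by
      intro h
      have := c.length_edges
      rw [h] at this
      have h3 := hc.three_le_length
      simp at this
      omega
    obtain ⟨e, he⟩ := List.exists_mem_of_ne_nil _ h1
    induction e using Sym2.ind with
    | _ a b =>
      obtain ⟨x, y, k, h, hk, rfl, rfl⟩ := subdiv_adj_exists hj (cadj he)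
      exact ⟨x, y, h, Qzero h hk he⟩
  obtain ⟨a, b, hab⟩ := hne
  have hleaf : ∀ a b, H.Adj a b → ∃ c, c ≠ b ∧ H.Adj a c := by
    rintro a b ⟨h, hQ⟩
    have hQ' : s(.inl a, PP Γ j a b 1) ∈ c.edges := by
      have : s(PP Γ j a b 0, PP Γ j a b 1) ∈ c.edges := hQ
      rwa [PP_zero] at this
    obtain ⟨w, hw, hwe⟩ := leaf _ _ hQ'
    obtain ⟨z, hz, rfl⟩ := subdiv_adj_inl hj (cadj hwe)
    refine ⟨z, fun h => hw (by rw [h]), hz, ?_⟩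
    change s(PP Γ j a z 0, PP Γ j a z 1) ∈ c.edges
    rwa [PP_zero]
  have hg := leafless_girth Γ H hle hab hleaf
  let E : Finset (V × V) := Finset.univ.filter (fun e => e.1 < e.2 ∧ H.Adj e.1 e.2)
  have hE : H.edgeFinset.card ≤ E.card := by
    have : H.edgeFinset ⊆ E.image (fun e => s(e.1, e.2)) := by
      intro e he
      induction e using Sym2.ind with
      | _ x y =>
        rw [mem_edgeFinset, mem_edgeSet] at he
        rw [Finset.mem_image]
        rcases lt_or_gt_of_ne he.ne with hlt | hlt
        · exact ⟨(x, y), by simp [E, hlt, he], rfl⟩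
        · exact ⟨(y, x), by simp [E, hlt, he.symm], Sym2.eq_swap⟩
    exact (Finset.card_le_card this).trans Finset.card_image_le
  have hinj : (E ×ˢ Finset.range j).card ≤ c.edges.toFinset.card := by
    apply Finset.card_le_card_of_injOn
      (fun t => s(PP Γ j t.1.1 t.1.2 t.2, PP Γ j t.1.1 t.1.2 (t.2 + 1)))
    · rintro ⟨⟨x, y⟩, k⟩ ht
      simp only [E, Finset.coe_product, Set.mem_prod, Finset.mem_coe, Finset.mem_filter,
        Finset.mem_univ, true_and, Finset.mem_range] at ht
      simp only [List.coe_toFinset, Set.mem_ofPred_eq]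
      exact Qall ht.1.2.1 (by omega) ht.1.2.2 k ht.2
    · rintro ⟨⟨x, y⟩, k⟩ ht ⟨⟨x', y'⟩, k'⟩ ht' heq
      simp only [E, Finset.coe_product, Set.mem_prod, Finset.mem_coe, Finset.mem_filter,
        Finset.mem_univ, true_and, Finset.mem_range] at ht ht'
      simp only [Sym2.eq_iff] at heq
      obtain ⟨⟨hlt, hadj, -⟩, hk⟩ := ht
      obtain ⟨⟨hlt', hadj', -⟩, hk'⟩ := ht'
      have fin : x = x' ∧ y = y' → k = k' := by
        rintro ⟨rfl, rfl⟩
        rcases heq with ⟨h1, h2⟩ | ⟨h1, h2⟩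
        · exact PP_inj_pos hj hadj (by omega) (by omega) h1
        · have e1 := PP_inj_pos hj hadj (by omega) (by omega) h1
          have e2 := PP_inj_pos hj hadj (by omega) (by omega) h2
          omega
      have main : x = x' ∧ y = y' := by
        rcases hj.eq_or_lt with hj1 | hj1
        · have : k = 0 := by omega
          have : k' = 0 := by omega
          subst k k' j
          rw [PP_zero, PP_zero, PP_end le_rfl, PP_end le_rfl] at heq
          rcases heq with ⟨h1, h2⟩ | ⟨h1, h2⟩
          · exact ⟨Sum.inl.inj h1, Sum.inl.inj h2⟩
          · cases Sum.inl.inj h1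
            cases Sum.inl.inj h2
            exact (lt_asymm hlt hlt').elim
        · have step : ∀ {a b : ℕ}, 0 < a → a < j → b ≤ j → PP Γ j x' y' b = PP Γ j x y a →
              x = x' ∧ y = y' := by
            intro a b h0 ha hb he
            rcases PP_inj hj hadj hadj' h0 ha hb he with h1 | h1
            · exact ⟨h1.1.symm, h1.2.1.symm⟩
            · obtain ⟨rfl, rfl, -⟩ := h1
              exact (lt_asymm hlt hlt').elim
          rcases Nat.eq_zero_or_pos k with hk0 | hk0
          · subst k
            rcases heq with ⟨h1, h2⟩ | ⟨h1, h2⟩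
            · exact step (by omega) hj1 (by omega) h2.symm
            · exact step (by omega) hj1 (by omega) h2.symm
          · rcases heq with ⟨h1, h2⟩ | ⟨h1, h2⟩
            · exact step hk0 hk (by omega) h1.symm
            · exact step hk0 hk (by omega) h1.symm
      have := fin main
      obtain ⟨rfl, rfl⟩ := main
      rw [this]
  rw [Finset.card_product, Finset.card_range] at hinj
  have h5 := c.edges.toFinset_card_le
  rw [Walk.length_edges] at h5
  calc j * Γ.girth ≤ j * E.card := Nat.mul_le_mul_left _ (hg.trans hE)
    _ = E.card * j := Nat.mul_comm _ _
    _ ≤ c.length := hinj.trans h5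

end Subdivision
section Count

open SimpleGraph

lemma TSet_count {V : Type} [Fintype V] [LinearOrder V] {Γ : SimpleGraph V} [DecidableRel Γ.Adj]
    {j d : ℕ} (hj : 1 ≤ j) (hd : 3 ≤ d) (hreg : ∀ v : V, (Γ.neighborSet v).ncard = d) (n : ℕ) :
    ∀ (x y : V) (k : ℕ), Γ.Adj x y → k < j → 2 * n < j * Γ.girth →
    ((d : ℝ) - 1) ^ (((n : ℝ) - ((j : ℝ) - k - 1)) / j) ≤
      ((TSet (subdiv Γ j) (PP Γ j x y k) (PP Γ j x y (k + 1)) n).ncard : ℝ) := by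
  classical
  have hd1 : (1 : ℝ) ≤ (d : ℝ) - 1 := by
    have : (3 : ℝ) ≤ d := by exact_mod_cast hd
    linarith
  have hj0 : (0 : ℝ) < j := by exact_mod_cast hj
  have hL : ∀ v (c : (subdiv Γ j).Walk v v), c.IsCycle → j * Γ.girth ≤ c.length :=
    fun v c hc => subdiv_cycle_length hj c hc
  induction n with
  | zero =>
    intro x y k h hk hn
    rw [TSet_zero (subdiv_adj_PP hj h hk), Set.ncard_singleton]
    have hk' : (k : ℝ) + 1 ≤ j := by exact_mod_cast hk
    push_cast
    apply Real.rpow_le_one_of_one_le_of_nonpos hd1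
    apply div_nonpos_of_nonpos_of_nonneg _ hj0.le
    linarith
  | succ n ih =>
    intro x y k h hk hn
    have hadj := subdiv_adj_PP hj h hk
    rcases (show k + 1 ≤ j from hk).eq_or_lt with hk1 | hk1
    · have hy : PP Γ j x y (k + 1) = .inl y := by rw [hk1, PP_end hj]
      have hx : PP Γ j x y k = PP Γ j y x 1 := by
        rw [← PP_symm hj h (by omega)]
        congr 1
        omega
      let Z : Finset V := (Γ.neighborFinset y).erase x
      have hZ : ∀ z ∈ Z, Γ.Adj y z ∧ z ≠ x := by
        intro z hz
        simp only [Z, Finset.mem_erase, mem_neighborFinset] at hz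
        exact ⟨hz.2, hz.1⟩
      have hZc : Z.card = d - 1 := by
        rw [Finset.card_erase_of_mem (by simpa using h.symm), ← hreg y,
          Set.ncard_eq_toFinset_card', neighborFinset]
      have hsum := TSet_succ hL hadj (n := n) hn (Z.image (fun z => PP Γ j y z 1)) (by
        intro w hw
        obtain ⟨z, hz, rfl⟩ := Finset.mem_image.mp hw
        obtain ⟨hz1, hz2⟩ := hZ z hz
        refine ⟨?_, ?_⟩
        · have := subdiv_adj_PP hj hz1 (k := 0) (by omega)
          rw [PP_zero] at this
          rw [hy]
          exact this
        · rw [hx]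
          intro he
          exact hz2 (PP_one_inj hj h.symm hz1 he))
      rw [Finset.sum_image (by
        intro z hz z' hz' he
        exact PP_one_inj hj (hZ z' hz').1 (hZ z hz).1 he)] at hsum
      have hsumR : (∑ z ∈ Z, ((TSet (subdiv Γ j) (PP Γ j x y (k + 1)) (PP Γ j y z 1) n).ncard : ℝ))
          ≤ ((TSet (subdiv Γ j) (PP Γ j x y k) (PP Γ j x y (k + 1)) (n + 1)).ncard : ℝ) := by
        exact_mod_cast hsum
      refine le_trans ?_ hsumR
      have hlow : ∀ z ∈ Z, ((d : ℝ) - 1) ^ (((n : ℝ) - ((j : ℝ) - (0 : ℕ) - 1)) / j) ≤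
          ((TSet (subdiv Γ j) (PP Γ j x y (k + 1)) (PP Γ j y z 1) n).ncard : ℝ) := by
        intro z hz
        have := ih y z 0 (hZ z hz).1 (by omega) (by omega)
        rw [PP_zero] at this
        rw [hy]
        exact this
      have h3 := Finset.card_nsmul_le_sum Z _ _ hlow
      refine le_trans (le_of_eq ?_) h3
      rw [hZc, nsmul_eq_mul, Nat.cast_sub (by omega), Nat.cast_one]
      have hjk : (k : ℝ) + 1 = j := by exact_mod_cast hk1
      rw [← Real.rpow_one_add' (by linarith)]
      · congr 1
        push_cast
        rw [← hjk]
        field_simp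
        ring
      · push_cast
        have : (1 : ℝ) + ((n : ℝ) - (j - 0 - 1)) / j = ((n : ℝ) + 1) / j := by
          field_simp
          ring
        rw [this]
        positivity
    · have hsum := TSet_succ hL hadj (n := n) hn {PP Γ j x y (k + 2)} (by
        intro w hw
        rw [Finset.mem_singleton] at hw
        subst hw
        refine ⟨subdiv_adj_PP hj h hk1, ?_⟩
        intro he
        have := PP_inj_pos hj h (by omega) (by omega) he
        omega)
      rw [Finset.sum_singleton] at hsum
      have h1 := ih x y (k + 1) h hk1 (by omega)
      have h2 : ((TSet (subdiv Γ j) (PP Γ j x y (k + 1)) (PP Γ j x y (k + 2)) n).ncard : ℝ) ≤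
          ((TSet (subdiv Γ j) (PP Γ j x y k) (PP Γ j x y (k + 1)) (n + 1)).ncard : ℝ) := by
        exact_mod_cast hsum
      refine le_trans (le_of_eq ?_) (h1.trans h2)
      congr 2
      push_cast
      ring

lemma TSet_subset_Sigma {V : Type} [LinearOrder V] {Γ : SimpleGraph V} {j : ℕ} {L r : ℕ}
    (hL : ∀ v (c : (subdiv Γ j).Walk v v), c.IsCycle → L ≤ c.length)
    (m v₁ : V ⊕ SubIdx Γ j) (h0 : (subdiv Γ j).dist m v₁ ≠ 0)
    (hm : 4 * (subdiv Γ j).dist m v₁ ≤ L) (hr : 16 * r ≤ L) :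
    ∃ w, (subdiv Γ j).Adj w v₁ ∧ TSet (subdiv Γ j) w v₁ r ⊆ SigmaSet Γ j m v₁ r := by
  classical
  have hreach : (subdiv Γ j).Reachable m v₁ := Reachable.of_dist_ne_zero h0
  obtain ⟨q0, hq0p, hq0⟩ := hreach.symm.exists_path_of_dist
  rw [SimpleGraph.dist_comm] at hq0
  cases q0 with
  | nil => simp at h0
  | @cons _ w _ hadj q1 =>
    refine ⟨w, hadj.symm, ?_⟩
    rintro x ⟨p, hp, hpl, hps⟩
    have hdist : (subdiv Γ j).dist v₁ x = r := by
      have hle : (subdiv Γ j).dist v₁ x ≤ r := hpl ▸ dist_le p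
      obtain ⟨p', hp', hpl'⟩ := (Walk.reachable p).exists_path_of_dist
      have := path_unique_of_short hL p p' hp hp' (by omega)
      rw [← hpl', ← this, hpl]
    refine ⟨hdist, ?_⟩
    intro p' q' hp' hq' y hyp hyq
    have e1 : p'.reverse = p := by
      apply path_unique_of_short hL _ _ (Walk.isPath_of_length_eq_dist _ hp').reverse hp
      rw [Walk.length_reverse, hp', dist_comm, hdist, hpl]
      omega
    have e2 : q'.reverse = Walk.cons hadj q1 := by
      apply path_unique_of_short hL _ _ (Walk.isPath_of_length_eq_dist _ hq').reverse hq0p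
      rw [Walk.length_reverse, hq', hq0]
      omega
    have hy1 : y ∈ p.support := by
      rw [← e1, Walk.support_reverse, List.mem_reverse]
      exact hyp
    have hy2 : y ∈ (Walk.cons hadj q1).support := by
      rw [← e2, Walk.support_reverse, List.mem_reverse]
      exact hyq
    by_contra hne
    have hy3 : y ∈ q1.support := by
      rw [Walk.support_cons, List.mem_cons] at hy2
      exact hy2.resolve_left hne
    have hl1 := p.length_takeUntil_le_length hy1
    have hl2 := (Walk.cons hadj q1).length_takeUntil_le_length hy2
    have e3 := path_unique_of_short hL (p.takeUntil y hy1) ((Walk.cons hadj q1).takeUntil y hy2)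
      (hp.takeUntil hy1) (hq0p.takeUntil hy2) (by omega)
    rw [Walk.takeUntil_cons hy3 (Ne.symm hne)] at e3
    apply hps
    apply p.support_takeUntil_subset_support hy1
    rw [e3, Walk.support_cons]
    exact List.mem_cons_of_mem _ (Walk.start_mem_support _)

lemma card_le_pow {V : Type} [Fintype V] [LinearOrder V] {Γ : SimpleGraph V} [DecidableRel Γ.Adj]
    {d : ℕ} (hconn : Γ.Connected) (hreg : ∀ v : V, (Γ.neighborSet v).ncard = d) :
    Fintype.card V ≤ (d + 1) ^ Γ.diam := by
  classical
  obtain ⟨u⟩ := hconn.nonempty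
  have key : ∀ n : ℕ, (Finset.univ.filter (fun v => Γ.dist u v ≤ n)).card ≤ (d + 1) ^ n := by
    intro n
    induction n with
    | zero =>
      rw [pow_zero, Finset.card_le_one]
      intro a ha b hb
      simp only [Finset.mem_filter, Finset.mem_univ, true_and, Nat.le_zero,
        hconn.dist_eq_zero_iff] at ha hb
      rw [← ha, ← hb]
    | succ n ih =>
      have hsub : Finset.univ.filter (fun v => Γ.dist u v ≤ n + 1) ⊆
          (Finset.univ.filter (fun v => Γ.dist u v ≤ n)).biUnion
            (fun x => insert x (Γ.neighborFinset x)) := by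
        intro v hv
        simp only [Finset.mem_filter, Finset.mem_univ, true_and] at hv
        simp only [Finset.mem_biUnion, Finset.mem_filter, Finset.mem_univ, true_and,
          Finset.mem_insert, mem_neighborFinset]
        obtain ⟨p, hp⟩ := hconn.exists_walk_length_eq_dist v u
        rw [SimpleGraph.dist_comm] at hp
        cases p with
        | nil => exact ⟨u, by simp, Or.inl rfl⟩
        | @cons _ w _ h q =>
          refine ⟨w, ?_, Or.inr h.symm⟩
          have := dist_le q
          rw [SimpleGraph.dist_comm] at this
          rw [Walk.length_cons] at hp
          omega
      refine (Finset.card_le_card hsub).trans ?_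
      refine (Finset.card_biUnion_le_card_mul _ _ (d + 1) ?_).trans ?_
      · intro x _
        refine (Finset.card_insert_le _ _).trans ?_
        rw [← hreg x, Set.ncard_eq_toFinset_card', neighborFinset]
      · rw [pow_succ]
        exact Nat.mul_le_mul_right _ ih
  have hne : Nonempty V := ⟨u⟩
  have htop : Γ.ediam ≠ ⊤ := connected_iff_ediam_ne_top.mp hconn
  have := key Γ.diam
  rw [Finset.filter_true_of_mem (fun v _ => dist_le_diam htop)] at this
  exact this

lemma card_subdiv_le {V : Type} [Fintype V] [LinearOrder V] (Γ : SimpleGraph V)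
    [DecidableRel Γ.Adj] {j : ℕ} (hj : 1 ≤ j) :
    Fintype.card (V ⊕ SubIdx Γ j) ≤ j * Fintype.card V ^ 2 := by
  have h1 : Fintype.card (SubIdx Γ j) ≤ Fintype.card (V × V × Fin (j - 1)) :=
    Fintype.card_le_of_injective (fun s : SubIdx Γ j => s.1) Subtype.val_injective
  rw [Fintype.card_sum]
  rw [Fintype.card_prod, Fintype.card_prod, Fintype.card_fin] at h1
  obtain ⟨i, rfl⟩ : ∃ i, j = i + 1 := ⟨j - 1, by omega⟩
  rw [Nat.add_sub_cancel] at h1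
  nlinarith [Nat.le_self_pow (two_ne_zero) (Fintype.card V)]

end Count

/-- For a `d`-regular graph `Θ` (`d ≥ 3`) with girth `g` and
`diam Θ ≤ C·g`, `j ≥ 1`, and vertices `m, v₁` of the `j`-subdivision with
`ε·jg ≤ d(m,v₁) ≤ jg/4` (`0 < ε ≤ 1/8`), the set `Σ` of points at distance
`⌊ε·jg/2⌋` from `v₁` whose geodesic to `v₁` meets the geodesic from `m` to `v₁`
only in `v₁` satisfies `|Σ| ≥ (d-1)^{εg/2-2}`, and there is `μ > 0` depending only on
`C, d, j, ε` with `|Σ| ≥ |V(Θ^{(j)})|^μ` for all sufficiently large `g`. -/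
theorem stmt_16 (C : ℝ) (d j : ℕ) (ε : ℝ) (hC : 0 < C) (hd : 3 ≤ d) (hj : 1 ≤ j)
    (hε0 : 0 < ε) (hε : ε ≤ 1 / 8) :
    ∃ μ : ℝ, 0 < μ ∧ ∃ g₀ : ℕ,
      ∀ (V : Type) [Fintype V] [LinearOrder V] (Γ : SimpleGraph V)
        [DecidableRel Γ.Adj] (g : ℕ) (m v₁ : V ⊕ SubIdx Γ j),
        Γ.Connected → 0 < g → Γ.girth = g →
        (∀ v : V, (Γ.neighborSet v).ncard = d) → (Γ.diam : ℝ) ≤ C * g →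
        ε * (j * g) ≤ ((subdiv Γ j).dist m v₁ : ℝ) →
        4 * (subdiv Γ j).dist m v₁ ≤ j * g →
        ((d : ℝ) - 1) ^ (ε * g / 2 - 2) ≤
            ((SigmaSet Γ j m v₁ ⌊ε * (j * g) / 2⌋₊).ncard : ℝ) ∧
          (g₀ ≤ g →
            (Fintype.card (V ⊕ SubIdx Γ j) : ℝ) ^ μ ≤
              ((SigmaSet Γ j m v₁ ⌊ε * (j * g) / 2⌋₊).ncard : ℝ)) := by
  classical
  have hd1 : (1 : ℝ) < (d : ℝ) - 1 := by
    have : (3 : ℝ) ≤ d := by exact_mod_cast hd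
    linarith
  have hj0 : (0 : ℝ) < j := by exact_mod_cast hj
  have hj1 : (1 : ℝ) ≤ j := by exact_mod_cast hj
  have hdp : (1 : ℝ) < (d : ℝ) + 1 := by linarith
  let K : ℝ := j * ((d : ℝ) + 1) ^ (2 * C)
  have hK : 1 < K := by
    have : 1 < ((d : ℝ) + 1) ^ (2 * C) := Real.one_lt_rpow hdp (by linarith)
    change 1 < (j : ℝ) * ((d : ℝ) + 1) ^ (2 * C)
    nlinarith
  have hlK : 0 < Real.log K := Real.log_pos hK
  have hld : 0 < Real.log ((d : ℝ) - 1) := Real.log_pos hd1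
  refine ⟨ε * Real.log ((d : ℝ) - 1) / (4 * Real.log K), by positivity, ⌈8 / ε⌉₊, ?_⟩
  intro V _ _ Γ _ g m v₁ hconn hg hgirth hreg hdiam hlow hup
  have hg0 : (0 : ℝ) < g := by exact_mod_cast hg
  have hg1 : (1 : ℝ) ≤ g := by exact_mod_cast hg
  have hL : ∀ v (c : (subdiv Γ j).Walk v v), c.IsCycle → j * g ≤ c.length := by
    intro v c hc
    rw [← hgirth]
    exact subdiv_cycle_length hj c hc
  have hrpos : 0 ≤ ε * (j * g) / 2 := by positivity
  have hjg : (0 : ℝ) < j * g := by positivity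
  have hjgN : 0 < j * g := by positivity
  generalize hr : ⌊ε * (j * g) / 2⌋₊ = r
  have hr1 : (r : ℝ) ≤ ε * (j * g) / 2 := by
    rw [← hr]; exact Nat.floor_le hrpos
  have hr2 : ε * (j * g) / 2 < (r : ℝ) + 1 := by
    rw [← hr]; exact Nat.lt_floor_add_one _
  have hr16 : 16 * r ≤ j * g := by
    have : (16 : ℝ) * r ≤ j * g := by nlinarith
    exact_mod_cast this
  have hdist : (subdiv Γ j).dist m v₁ ≠ 0 := by
    intro h
    rw [h] at hlow
    have : 0 < ε * (j * g) := by positivity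
    simp only [Nat.cast_zero] at hlow
    linarith
  obtain ⟨w, hw, hsub⟩ := TSet_subset_Sigma hL m v₁ hdist hup hr16
  have hcard : ((d : ℝ) - 1) ^ (ε * g / 2 - 2) ≤ ((SigmaSet Γ j m v₁ r).ncard : ℝ) := by
    obtain ⟨x, y, k, h, hk, rfl, rfl⟩ := subdiv_adj_exists hj hw
    have h1 := TSet_count hj hd hreg r x y k h hk (by rw [hgirth]; omega)
    have h2 := Set.ncard_le_ncard hsub (Set.toFinite _)
    have h3 : ((TSet (subdiv Γ j) (PP Γ j x y k) (PP Γ j x y (k + 1)) r).ncard : ℝ) ≤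
      ((SigmaSet Γ j m (PP Γ j x y (k + 1)) r).ncard : ℝ) := by exact_mod_cast h2
    refine le_trans ?_ (h1.trans h3)
    apply Real.rpow_le_rpow_of_exponent_le hd1.le
    rw [le_div_iff₀ hj0]
    have : (0 : ℝ) ≤ k := Nat.cast_nonneg k
    nlinarith
  refine ⟨hcard, fun hgg => le_trans ?_ hcard⟩
  have hgg' : 8 / ε ≤ g := (Nat.le_ceil _).trans (by exact_mod_cast hgg)
  rw [div_le_iff₀ hε0] at hgg'
  have hN : (Fintype.card (V ⊕ SubIdx Γ j) : ℝ) ≤ K ^ (g : ℝ) := by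
    have h1 : (Fintype.card (V ⊕ SubIdx Γ j) : ℝ) ≤ j * (Fintype.card V : ℝ) ^ 2 := by
      exact_mod_cast card_subdiv_le Γ hj
    have h2 : (Fintype.card V : ℝ) ≤ ((d : ℝ) + 1) ^ Γ.diam := by
      exact_mod_cast card_le_pow hconn hreg
    have h3 : ((d : ℝ) + 1) ^ Γ.diam ≤ ((d : ℝ) + 1) ^ (C * g) := by
      rw [← Real.rpow_natCast]
      exact Real.rpow_le_rpow_of_exponent_le hdp.le hdiam
    have h4 : (Fintype.card V : ℝ) ^ 2 ≤ (((d : ℝ) + 1) ^ (C * g)) ^ 2 := by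
      gcongr
      exact h2.trans h3
    have h5 : (((d : ℝ) + 1) ^ (C * g)) ^ 2 = (((d : ℝ) + 1) ^ (2 * C)) ^ (g : ℝ) := by
      rw [← Real.rpow_natCast, ← Real.rpow_mul (by linarith), ← Real.rpow_mul (by linarith)]
      congr 1
      push_cast
      ring
    have h6 : (j : ℝ) ≤ (j : ℝ) ^ (g : ℝ) := Real.self_le_rpow_of_one_le hj1 hg1
    change _ ≤ ((j : ℝ) * ((d : ℝ) + 1) ^ (2 * C)) ^ (g : ℝ)
    rw [Real.mul_rpow hj0.le (by positivity)]
    calc _ ≤ _ := h1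
      _ ≤ (j : ℝ) ^ (g : ℝ) * (((d : ℝ) + 1) ^ (2 * C)) ^ (g : ℝ) := by
        rw [← h5]
        gcongr
  have hμ : 0 ≤ ε * Real.log ((d : ℝ) - 1) / (4 * Real.log K) := by positivity
  refine (Real.rpow_le_rpow (Nat.cast_nonneg _) hN hμ).trans ?_
  rw [← Real.rpow_mul (by linarith), Real.rpow_def_of_pos (by linarith),
    Real.rpow_def_of_pos (by linarith : (0 : ℝ) < (d : ℝ) - 1)]
  apply Real.exp_le_exp.mpr
  have e1 : Real.log K * (g * (ε * Real.log ((d : ℝ) - 1) / (4 * Real.log K))) =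
      Real.log ((d : ℝ) - 1) * (ε * g / 4) := by
    field_simp
  rw [e1]
  apply mul_le_mul_of_nonneg_left _ hld.le
  nlinarith
end
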